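/- For all N ∈ ℕ with N ≥ 1, all 0 < q < 1, 0 < a < 1, 0 < b < 1, and all n, x ∈ {0, 1, …, N}, one has the duality/symmetry q^{−n(n−1)/2} (−a)^{−n} · [(a;q)_n / (b;q)_n] · Q_n^{a,b,N;q}(x) = Q_n^{b^{−1},a^{−1},N;q^{−1}}(N−x), where for any real q' ∉ {0,1} with all denominators nonzero, Q_n^{a',b',N;q'}(x) = ∑_{k=0}^{n} [(q'^{−n};q')_k (a'b'q'^{n−1};q')_k (q'^{x−N};q')_k / ((a';q')_k (q'^{−N};q')_k (q';q')_k)] q'^k. -/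

import Mathlib

open Finset

/-- The q-Pochhammer symbol `(c;q)_k = ∏_{j=0}^{k-1} (1 - c q^j)`. -/
noncomputable def qPoch (q c : ℝ) (k : ℕ) : ℝ := ∏ j ∈ Finset.range k, (1 - c * q ^ j)

/-- The q-Hahn function `Q_n^{a,b,N;q}(x) =
∑_{k=0}^{n} [(q^{−n};q)_k (abq^{n−1};q)_k (q^{x−N};q)_k /
((a;q)_k (q^{−N};q)_k (q;q)_k)] q^k`. -/
noncomputable def qHahn (a b : ℝ) (N : ℕ) (q : ℝ) (n x : ℕ) : ℝ :=
  ∑ k ∈ Finset.range (n + 1),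
    qPoch q (q ^ (-(n : ℤ))) k * qPoch q (a * b * q ^ ((n : ℤ) - 1)) k *
      qPoch q (q ^ ((x : ℤ) - (N : ℤ))) k /
      (qPoch q a k * qPoch q (q ^ (-(N : ℤ))) k * qPoch q q k) * q ^ k

lemma qPoch_succ (q c : ℝ) (k : ℕ) : qPoch q c (k + 1) = qPoch q c k * (1 - c * q ^ k) := by
  simp [qPoch, Finset.prod_range_succ]

lemma qPoch_zero (q c : ℝ) : qPoch q c 0 = 1 := by simp [qPoch]

lemma qPoch_add (q c : ℝ) (j m : ℕ) :
    qPoch q c (j + m) = qPoch q c j * qPoch q (c * q ^ j) m := by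
  simp only [qPoch, Finset.prod_range_add]
  congr 1
  apply Finset.prod_congr rfl
  intro i _
  rw [pow_add]; ring

lemma qPoch_succ' (q c : ℝ) (k : ℕ) :
    qPoch q c (k + 1) = (1 - c) * qPoch q (c * q) k := by
  rw [add_comm, qPoch_add]; simp [qPoch]

/-- Gaussian binomials. -/
noncomputable def gb (q : ℝ) : ℕ → ℕ → ℝ
  | _, 0 => 1
  | 0, _ + 1 => 0
  | k + 1, j + 1 => q ^ (j + 1) * gb q k (j + 1) + gb q k j

lemma gb_zero (q : ℝ) (k : ℕ) : gb q k 0 = 1 := by cases k <;> simp [gb]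

lemma gb_succ (q : ℝ) (k j : ℕ) :
    gb q (k + 1) (j + 1) = q ^ (j + 1) * gb q k (j + 1) + gb q k j := by simp [gb]

lemma gb_gt (q : ℝ) (k : ℕ) : ∀ j, k < j → gb q k j = 0 := by
  induction k with
  | zero => intro j hj; cases j with
    | zero => omega
    | succ j => simp [gb]
  | succ k ih => intro j hj; cases j with
    | zero => omega
    | succ j => rw [gb_succ, ih _ (by omega), ih _ (by omega)]; simp

lemma gb_mul (q : ℝ) (s : ℕ) : ∀ j m, j + m = s →
    gb q (j + m) j * qPoch q q j * qPoch q q m = qPoch q q (j + m) := by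
  induction s with
  | zero =>
    intro j m h
    obtain ⟨rfl, rfl⟩ : j = 0 ∧ m = 0 := by omega
    simp [gb, qPoch_zero]
  | succ s ih =>
    intro j m h
    cases j with
    | zero => simp [gb_zero, qPoch_zero]
    | succ j =>
      cases m with
      | zero =>
        have h1 := ih j 0 (by omega)
        simp only [add_zero, qPoch_zero, mul_one] at h1 ⊢
        rw [gb_succ, gb_gt q j (j + 1) (by omega), qPoch_succ]
        linear_combination (1 - q * q ^ j) * h1
      | succ m =>
        have h1 := ih (j + 1) m (by omega)
        have h2 := ih j (m + 1) (by omega)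
        have e1 : j + 1 + (m + 1) = (j + m + 1) + 1 := by omega
        have e2 : j + 1 + m = j + m + 1 := by omega
        have e3 : j + (m + 1) = j + m + 1 := by omega
        rw [e2] at h1
        rw [e3] at h2
        rw [e1, gb_succ, qPoch_succ q q (j + m + 1)]
        rw [qPoch_succ q q j] at h1 ⊢
        rw [qPoch_succ q q m] at h2 ⊢
        have e4 : q ^ (j + m + 1) = q ^ j * q ^ m * q := by ring
        rw [e4, pow_succ]
        linear_combination (1 - q * q ^ m) * q ^ j * q * h1 + (1 - q * q ^ j) * h2

/-- Auxiliary product. -/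
noncomputable def PP (q d e : ℝ) (j : ℕ) : ℝ := ∏ i ∈ Finset.range j, (q ^ i * (d * q ^ i - e))

lemma PP_shift (q d e : ℝ) (j : ℕ) : PP q (d * q) (e * q) j = q ^ j * PP q d e j := by
  unfold PP
  rw [← Finset.card_range j, ← Finset.prod_const, Finset.card_range, ← Finset.prod_mul_distrib]
  apply Finset.prod_congr rfl
  intros; ring

lemma vand1 (q : ℝ) (k : ℕ) : ∀ d e : ℝ, qPoch q e k =
    ∑ j ∈ Finset.range (k + 1), gb q k j * PP q d e j * qPoch q (d * q ^ j) (k - j) := by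
  induction k with
  | zero => intro d e; simp [qPoch, gb, PP]
  | succ k ih =>
    intro d e
    rw [qPoch_succ', ih (d * q) (e * q), Finset.mul_sum]
    have h1 : ∀ j ∈ Finset.range (k + 1),
        (1 - e) * (gb q k j * PP q (d * q) (e * q) j * qPoch q (d * q * q ^ j) (k - j)) =
        q ^ j * gb q k j * PP q d e j * qPoch q (d * q ^ j) (k + 1 - j) +
        gb q k j * PP q d e (j + 1) * qPoch q (d * q ^ (j + 1)) (k - j) := by
      intro j hj
      have hj' : j ≤ k := by simpa [Nat.lt_succ_iff] using hj
      have e1 : k + 1 - j = (k - j) + 1 := by omega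
      rw [e1, qPoch_succ', PP_shift]
      have e2 : d * q * q ^ j = d * q ^ j * q := by ring
      have e3 : d * q ^ (j + 1) = d * q ^ j * q := by ring
      have e4 : PP q d e (j + 1) = PP q d e j * (q ^ j * (d * q ^ j - e)) := by
        simp [PP, Finset.prod_range_succ]
      rw [e2, e3, e4]; ring
    rw [Finset.sum_congr rfl h1, Finset.sum_add_distrib]
    rw [Finset.sum_range_succ' _ (k + 1)]
    have h2 : ∑ j ∈ Finset.range (k + 1),
        q ^ j * gb q k j * PP q d e j * qPoch q (d * q ^ j) (k + 1 - j) =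
        ∑ j ∈ Finset.range (k + 1),
        q ^ (j + 1) * gb q k (j + 1) * PP q d e (j + 1) * qPoch q (d * q ^ (j + 1)) (k - j)
        + qPoch q d (k + 1) := by
      rw [Finset.sum_range_succ', Finset.sum_range_succ _ k, gb_gt q k (k + 1) (by omega)]
      simp [gb_zero, PP]
    rw [h2]
    simp only [gb_succ, gb_zero, Nat.add_sub_add_right]
    rw [add_right_comm, ← Finset.sum_add_distrib]
    congr 1
    · apply Finset.sum_congr rfl; intros; ring
    · simp [PP]

/-- weights -/
noncomputable def WW (q : ℝ) (M m : ℕ) : ℝ := qPoch q (q ^ (-(M : ℤ))) m / qPoch q q m * q ^ m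

lemma qq_ne {q : ℝ} (hq0 : 0 < q) (hq1 : q < 1) (m : ℕ) : qPoch q q m ≠ 0 := by
  unfold qPoch
  rw [Finset.prod_ne_zero_iff]
  intro i _
  have : q * q ^ i < 1 := by
    rw [← pow_succ']; exact pow_lt_one₀ hq0.le hq1 (by omega)
  linarith

lemma WW_zero (q : ℝ) (M : ℕ) : WW q M 0 = 1 := by simp [WW, qPoch]

lemma WW_gt {q : ℝ} (hq0 : 0 < q) (M : ℕ) : WW q M (M + 1) = 0 := by
  unfold WW
  rw [qPoch_succ]
  have : q ^ (-(M : ℤ)) * q ^ M = 1 := by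
    rw [zpow_neg, zpow_natCast]; field_simp
  rw [this]; simp

lemma WW_succ {q : ℝ} (hq0 : 0 < q) (hq1 : q < 1) (M m : ℕ) :
    WW q (M + 1) (m + 1) = (q ^ (m + 1))⁻¹ * WW q M (m + 1) - (q ^ m)⁻¹ * WW q M m := by
  unfold WW
  have h1 := qq_ne hq0 hq1 m
  have h2 := qq_ne hq0 hq1 (m + 1)
  rw [qPoch_succ' q (q ^ (-((M + 1 : ℕ) : ℤ)))]
  have e1 : q ^ (-((M + 1 : ℕ) : ℤ)) * q = q ^ (-(M : ℤ)) := by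
    rw [← zpow_add_one₀ hq0.ne']; congr 1; push_cast; ring
  have e2 : q ^ (-((M + 1 : ℕ) : ℤ)) = q ^ (-(M : ℤ)) * q⁻¹ := by
    rw [← e1]; field_simp
  rw [e1, e2]
  rw [qPoch_succ q (q ^ (-(M : ℤ)))]
  rw [qPoch_succ] at h2 ⊢
  have h3 : 1 - q * q ^ m ≠ 0 := right_ne_zero_of_mul h2
  generalize q ^ (-(M : ℤ)) = y at *
  field_simp
  ring

lemma vand2 {q : ℝ} (hq0 : 0 < q) (hq1 : q < 1) (C : ℝ) (M : ℕ) : ∀ A : ℝ,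
    ∑ m ∈ Finset.range (M + 1), WW q M m * qPoch q C m * qPoch q (A * q ^ m) (M - m) =
      ∏ i ∈ Finset.range M, (C - A * q ^ i) := by
  induction M with
  | zero => intro A; simp [WW_zero, qPoch]
  | succ M ih =>
    intro A
    have e0 : ∏ i ∈ Finset.range (M + 1), (C - A * q ^ i) =
        (C - A) * ∏ i ∈ Finset.range M, (C - A * q * q ^ i) := by
      rw [Finset.prod_range_succ', mul_comm]
      congr 1
      · simp
      · apply Finset.prod_congr rfl; intros; ring
    rw [e0, ← ih (A * q), Finset.mul_sum]
    have h1 : ∀ m ∈ Finset.range (M + 1),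
        (C - A) * (WW q M m * qPoch q C m * qPoch q (A * q * q ^ m) (M - m)) =
        (q ^ m)⁻¹ * WW q M m * qPoch q C m * qPoch q (A * q ^ m) (M + 1 - m) -
        (q ^ m)⁻¹ * WW q M m * qPoch q C (m + 1) * qPoch q (A * q ^ (m + 1)) (M - m) := by
      intro m hm
      have hm' : m ≤ M := by simpa [Nat.lt_succ_iff] using hm
      have e1 : M + 1 - m = (M - m) + 1 := by omega
      have e2 : A * q * q ^ m = A * q ^ m * q := by ring
      have e3 : A * q ^ (m + 1) = A * q ^ m * q := by ring
      rw [e1, qPoch_succ', qPoch_succ, e2, e3]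
      field_simp
      ring
    rw [Finset.sum_congr rfl h1, Finset.sum_sub_distrib]
    rw [Finset.sum_range_succ' _ (M + 1)]
    have h2 : ∑ m ∈ Finset.range (M + 1),
        (q ^ m)⁻¹ * WW q M m * qPoch q C m * qPoch q (A * q ^ m) (M + 1 - m) =
        ∑ m ∈ Finset.range (M + 1), (q ^ (m + 1))⁻¹ * WW q M (m + 1) * qPoch q C (m + 1) *
          qPoch q (A * q ^ (m + 1)) (M - m) + qPoch q A (M + 1) := by
      rw [Finset.sum_range_succ', Finset.sum_range_succ _ M, WW_gt hq0]
      simp [WW_zero, qPoch_zero]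
    rw [h2]
    simp only [WW_succ hq0 hq1, WW_zero, Nat.add_sub_add_right]
    rw [add_sub_right_comm, ← Finset.sum_sub_distrib]
    congr 1
    · apply Finset.sum_congr rfl; intros; ring
    · simp [qPoch_zero]

lemma WW_gb {q : ℝ} (hq0 : 0 < q) (hq1 : q < 1) (j m M : ℕ) :
    WW q (j + M) (j + m) * gb q (j + m) j = WW q (j + M) j * WW q M m := by
  have h := gb_mul q (j + m) j m rfl
  have h1 := qq_ne hq0 hq1 j
  have h2 := qq_ne hq0 hq1 m
  have h3 := qq_ne hq0 hq1 (j + m)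
  unfold WW
  rw [qPoch_add q (q ^ (-((j + M : ℕ) : ℤ)))]
  have e : q ^ (-((j + M : ℕ) : ℤ)) * q ^ j = q ^ (-(M : ℤ)) := by
    rw [← zpow_natCast, ← zpow_add₀ hq0.ne']; congr 1; push_cast; ring
  rw [e]
  field_simp
  rw [← h]; ring

/-- The transformation of the terminating 3φ2. -/
lemma transf {q : ℝ} (hq0 : 0 < q) (hq1 : q < 1) (n : ℕ) (a c d e : ℝ)
    (ha : ∀ k ≤ n, qPoch q a k ≠ 0) (hd : ∀ k ≤ n, qPoch q d k ≠ 0) :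
    ∑ k ∈ Finset.range (n + 1), WW q n k * qPoch q c k * qPoch q e k /
      (qPoch q a k * qPoch q d k) =
    ∑ j ∈ Finset.range (n + 1), WW q n j * qPoch q c j * PP q d e j / qPoch q d j *
      (∏ i ∈ Finset.range (n - j), (c * q ^ j - a * q ^ j * q ^ i)) / qPoch q a n := by
  have h1 : ∀ k ∈ Finset.range (n + 1), WW q n k * qPoch q c k * qPoch q e k /
      (qPoch q a k * qPoch q d k) = ∑ j ∈ Finset.range (k + 1),
        WW q n k * gb q k j * qPoch q c k * PP q d e j / (qPoch q a k * qPoch q d j) := by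
    intro k hk
    have hk' : k ≤ n := by simpa [Nat.lt_succ_iff] using hk
    rw [vand1 q k d e, Finset.mul_sum, Finset.sum_div]
    apply Finset.sum_congr rfl
    intro j hj
    have hj' : j ≤ k := by simpa [Nat.lt_succ_iff] using hj
    obtain ⟨m, rfl⟩ := Nat.exists_eq_add_of_le hj'
    have hd1 := hd _ hk'
    have ha1 := ha _ hk'
    rw [qPoch_add q d] at hd1 ⊢
    have hd2 := left_ne_zero_of_mul hd1
    have hd3 := right_ne_zero_of_mul hd1
    rw [Nat.add_sub_cancel_left]
    field_simp
  rw [Finset.sum_congr rfl h1]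
  have h2 : ∀ f : ℕ → ℕ → ℝ, ∑ k ∈ Finset.range (n + 1), ∑ j ∈ Finset.range (k + 1), f k j =
      ∑ j ∈ Finset.range (n + 1), ∑ m ∈ Finset.range (n - j + 1), f (j + m) j := by
    intro f
    rw [Finset.sum_sigma', Finset.sum_sigma']
    refine Finset.sum_bij' (fun p _ => ⟨p.2, p.1 - p.2⟩) (fun p _ => ⟨p.1 + p.2, p.1⟩) ?_ ?_ ?_ ?_ ?_
    · rintro ⟨k, j⟩ h; simp at h ⊢; omega
    · rintro ⟨k, j⟩ h; simp at h ⊢; omega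
    · rintro ⟨k, j⟩ h; simp at h ⊢; omega
    · rintro ⟨k, j⟩ h; simp at h ⊢
    · rintro ⟨k, j⟩ h
      simp at h ⊢
      rw [Nat.add_sub_cancel' (by omega)]
  rw [h2]
  apply Finset.sum_congr rfl
  intro j hj
  have hj' : j ≤ n := by simpa [Nat.lt_succ_iff] using hj
  obtain ⟨M, rfl⟩ := Nat.exists_eq_add_of_le hj'
  rw [Nat.add_sub_cancel_left, ← vand2 hq0 hq1, Finset.mul_sum, Finset.sum_div]
  apply Finset.sum_congr rfl
  intro m hm
  have hm' : m ≤ M := by simpa [Nat.lt_succ_iff] using hm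
  rw [WW_gb hq0 hq1]
  obtain ⟨r, rfl⟩ := Nat.exists_eq_add_of_le hm'
  rw [Nat.add_sub_cancel_left]
  have ha1 := ha _ le_rfl
  have hd1 := hd j hj'
  rw [qPoch_add q c j m]
  rw [← add_assoc, qPoch_add q a (j + m) r] at ha1
  rw [show qPoch q a (j + (m + r)) = qPoch q a (j + m) * qPoch q (a * q ^ j * q ^ m) r by
    rw [← add_assoc, qPoch_add, pow_add, mul_assoc]]
  rw [pow_add, ← mul_assoc] at ha1
  have ha2 := left_ne_zero_of_mul ha1
  have ha3 := right_ne_zero_of_mul ha1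
  generalize qPoch q (a * q ^ j * q ^ m) r = Y at *
  field_simp

lemma tri_split (q : ℝ) (n : ℕ) :
    q ^ (n * (n - 1) / 2) = ∏ i ∈ Finset.range n, q ^ i := by
  rw [Finset.prod_pow_eq_pow_sum, Finset.sum_range_id]

/-- evaluation of the inner product -/
lemma inner_eval (q a b c : ℝ) (j M : ℕ) (hc : c * q = a * b * q ^ (j + M)) (hq : q ≠ 0) :
    (∏ i ∈ Finset.range M, (c * q ^ j - a * q ^ j * q ^ i)) * ∏ i ∈ Finset.range j, q ^ i =
    (-a) ^ M * (∏ i ∈ Finset.range (j + M), q ^ i) * qPoch q (b * q ^ j) M := by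
  have h : qPoch q (b * q ^ j) M = ∏ i ∈ Finset.range M, (1 - b * q ^ j * q ^ (M - 1 - i)) := by
    unfold qPoch
    rw [← Finset.prod_range_reflect]
  rw [Finset.prod_range_add, h]
  have : (-a) ^ M = ∏ i ∈ Finset.range M, (-a) := by simp
  rw [this]
  rw [show ∀ x y z w : ℝ, x * (y * z) * w = (x * z * w) * y by intros; ring,
    ← Finset.prod_mul_distrib, ← Finset.prod_mul_distrib]
  congr 1
  apply Finset.prod_congr rfl
  intro i hi
  have hi' := Finset.mem_range.1 hi
  obtain ⟨r, rfl⟩ : ∃ r, M = i + 1 + r := ⟨M - (i + 1), by omega⟩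
  have e : i + 1 + r - 1 - i = r := by omega
  have hc' : c = a * b * q ^ (j + i + r) := by
    apply mul_right_cancel₀ hq
    rw [hc]; ring
  rw [e, hc']; ring

lemma qPoch_ne {q a : ℝ} (hq0 : 0 < q) (hq1 : q < 1) (ha0 : 0 < a) (ha1 : a < 1) (k : ℕ) :
    qPoch q a k ≠ 0 := by
  unfold qPoch
  rw [Finset.prod_ne_zero_iff]
  intro i _
  have h1 : q ^ i ≤ 1 := pow_le_one₀ hq0.le hq1.le
  have h2 : 0 < q ^ i := by positivity
  nlinarith

lemma one_sub_zpow_ne {q : ℝ} (hq0 : 0 < q) (hq1 : q < 1) (N i : ℕ) (h : i < N) :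
    1 - q ^ (-(N : ℤ)) * q ^ i ≠ 0 := by
  obtain ⟨r, rfl⟩ : ∃ r, N = i + 1 + r := ⟨N - (i + 1), by omega⟩
  have h1 : q ^ (r + 1) < 1 := pow_lt_one₀ hq0.le hq1 (by omega)
  rw [zpow_neg, zpow_natCast]
  intro h0
  have : q ^ (i + 1 + r) = q ^ i := by
    field_simp at h0
    linarith
  have h3 : q ^ i * (q ^ (r + 1) - 1) = 0 := by
    rw [← sub_eq_zero] at this
    rw [← this]; ring
  have h4 : 0 < q ^ i := by positivity
  rcases mul_eq_zero.1 h3 with h5 | h5 <;> linarith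

lemma qPochN_ne {q : ℝ} (hq0 : 0 < q) (hq1 : q < 1) (N k : ℕ) (h : k ≤ N) :
    qPoch q (q ^ (-(N : ℤ))) k ≠ 0 := by
  unfold qPoch
  rw [Finset.prod_ne_zero_iff]
  intro i hi
  exact one_sub_zpow_ne hq0 hq1 N i (by have := Finset.mem_range.1 hi; omega)

lemma qPoch_inv {q c : ℝ} (hq : q ≠ 0) (hc : c ≠ 0) (k : ℕ) :
    qPoch q⁻¹ c⁻¹ k = qPoch q c k * ((-c) ^ k * ∏ i ∈ Finset.range k, q ^ i)⁻¹ := by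
  have : (-c) ^ k = ∏ i ∈ Finset.range k, (-c) := by simp
  unfold qPoch
  rw [this, ← Finset.prod_mul_distrib, ← Finset.prod_inv_distrib, ← Finset.prod_mul_distrib]
  apply Finset.prod_congr rfl
  intro i _
  rw [inv_pow]
  field_simp
  ring

lemma PP_eval {q d e B : ℝ} (he : d = e * B) (j : ℕ) :
    PP q d e j = (∏ i ∈ Finset.range j, q ^ i) * ((-e) ^ j * qPoch q B j) := by
  have : (-e) ^ j = ∏ i ∈ Finset.range j, (-e) := by simp
  unfold PP qPoch
  rw [this, ← Finset.prod_mul_distrib, ← Finset.prod_mul_distrib]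
  apply Finset.prod_congr rfl
  intro i _
  rw [he]; ring

theorem qHahn_duality (N : ℕ) (hN : 1 ≤ N) (q a b : ℝ) (hq0 : 0 < q) (hq1 : q < 1)
    (ha0 : 0 < a) (ha1 : a < 1) (hb0 : 0 < b) (hb1 : b < 1)
    (n x : ℕ) (hn : n ≤ N) (hx : x ≤ N) :
    q ^ (-((n * (n - 1) / 2 : ℕ) : ℤ)) * (-a) ^ (-(n : ℤ)) *
        (qPoch q a n / qPoch q b n) * qHahn a b N q n x =
      qHahn b⁻¹ a⁻¹ N q⁻¹ n (N - x) := by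
  have hq := hq0.ne'
  set c := a * b * q ^ ((n : ℤ) - 1) with hc
  set d := q ^ (-(N : ℤ)) with hd
  set e := q ^ ((x : ℤ) - (N : ℤ)) with he
  have hS : qHahn a b N q n x = ∑ k ∈ Finset.range (n + 1), WW q n k * qPoch q c k * qPoch q e k /
      (qPoch q a k * qPoch q d k) := by
    unfold qHahn WW
    apply Finset.sum_congr rfl
    intro k _
    rw [← hc, ← hd, ← he]
    rw [div_mul_eq_mul_div, div_mul_eq_mul_div, div_mul_eq_mul_div, div_mul_eq_mul_div, div_div]
    congr 1 <;> ring
  rw [hS, transf hq0 hq1 n a c d e (fun k _ => qPoch_ne hq0 hq1 ha0 ha1 k)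
    (fun k hk => qPochN_ne hq0 hq1 N k (hk.trans hn))]
  unfold qHahn
  rw [Finset.mul_sum]
  apply Finset.sum_congr rfl
  intro j hj
  have hj' : j ≤ n := by simpa [Nat.lt_succ_iff] using hj
  have hcq : c * q = a * b * q ^ n := by
    rw [hc, mul_assoc, ← zpow_add_one₀ hq]; simp
  have hc0 : c ≠ 0 := by positivity
  have hd0 : d ≠ 0 := by positivity
  have he0 : e ≠ 0 := by positivity
  -- right-hand side
  have r1 : (q⁻¹ : ℝ) ^ (-(n : ℤ)) = (q ^ (-(n : ℤ)))⁻¹ := inv_zpow _ _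
  have r2 : b⁻¹ * a⁻¹ * q⁻¹ ^ ((n : ℤ) - 1) = c⁻¹ := by
    rw [hc, inv_zpow, mul_inv, mul_inv]; ring
  have r3 : (q⁻¹ : ℝ) ^ (((N - x : ℕ) : ℤ) - (N : ℤ)) = (q ^ (-(x : ℤ)))⁻¹ := by
    rw [inv_zpow]; congr 2; omega
  have r4 : (q⁻¹ : ℝ) ^ (-(N : ℤ)) = d⁻¹ := inv_zpow _ _
  rw [r1, r2, r3, r4]
  have hB0 : q ^ (-(x : ℤ)) ≠ 0 := by positivity
  have hn0 : q ^ (-(n : ℤ)) ≠ 0 := by positivity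
  have hdB : d = e * q ^ (-(x : ℤ)) := by
    rw [he, hd, ← zpow_add₀ hq]; congr 1; ring
  rw [qPoch_inv hq hn0, qPoch_inv hq hc0, qPoch_inv hq hB0, qPoch_inv hq hb0.ne',
    qPoch_inv hq hd0, qPoch_inv hq hq]
  rw [PP_eval hdB]
  obtain ⟨M, rfl⟩ := Nat.exists_eq_add_of_le hj'
  have hI := inner_eval q a b c j M hcq hq
  have hT : q ^ (-(((j + M) * (j + M - 1) / 2 : ℕ) : ℤ)) =
      (∏ i ∈ Finset.range (j + M), q ^ i)⁻¹ := by
    rw [zpow_neg, zpow_natCast, tri_split]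
  rw [hT, Nat.add_sub_cancel_left]
  have hT1 : (∏ i ∈ Finset.range (j + M), q ^ i) ≠ 0 := by positivity
  have hT2 : (∏ i ∈ Finset.range j, q ^ i) ≠ 0 := by positivity
  have n1 := qPoch_ne hq0 hq1 ha0 ha1 (j + M)
  have n2 := qPoch_ne hq0 hq1 hb0 hb1 (j + M)
  have n3 := qq_ne hq0 hq1 j
  have n4 : qPoch q d j ≠ 0 := qPochN_ne hq0 hq1 N j (by omega)
  rw [qPoch_add q b j M] at n2 ⊢
  have n5 := left_ne_zero_of_mul n2
  have n6 := right_ne_zero_of_mul n2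
  have hI' : (∏ i ∈ Finset.range M, (c * q ^ j - a * q ^ j * q ^ i)) =
    (-a) ^ M * (∏ i ∈ Finset.range (j + M), q ^ i) * qPoch q (b * q ^ j) M /
      ∏ i ∈ Finset.range j, q ^ i := by
    rw [← hI]; field_simp
  rw [hI']
  unfold WW
  have hnn : q ^ (-((j + M : ℕ) : ℤ)) = (q ^ (j + M))⁻¹ := by rw [zpow_neg, zpow_natCast]
  have hee : d * (q ^ (-(x : ℤ)))⁻¹ = e := by rw [hdB]; field_simp
  have key : (-a)⁻¹ * (-e) * q =
      (-q ^ (-((j + M : ℕ) : ℤ)))⁻¹ * (-c)⁻¹ * (-q ^ (-(x : ℤ)))⁻¹ * (-b) * (-d) * (-q) * q⁻¹ := by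
    have hc' : c = a * b * q ^ (j + M) / q := by rw [← hcq]; field_simp
    rw [hnn, hc', hdB]
    field_simp
  have key2 : ((-a) ^ j)⁻¹ * (-e) ^ j * q ^ j =
      ((-q ^ (-((j + M : ℕ) : ℤ))) ^ j)⁻¹ * ((-c) ^ j)⁻¹ * ((-q ^ (-(x : ℤ))) ^ j)⁻¹ *
        (-b) ^ j * (-d) ^ j * (-q) ^ j * (q⁻¹) ^ j := by
    simp only [← inv_pow, ← mul_pow]
    rw [← inv_pow] at *
    congr 1
  have hna : (-a) ^ (-((j + M : ℕ) : ℤ)) = ((-a) ^ j)⁻¹ * ((-a) ^ M)⁻¹ := by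
    rw [zpow_neg, zpow_natCast, pow_add, mul_inv]
  rw [hna]
  have hna0 : (-a) ≠ 0 := by linarith
  have p1 : (-a) ^ M ≠ 0 := pow_ne_zero _ hna0
  have p2 : (-b) ^ j ≠ 0 := pow_ne_zero _ (by linarith)
  have p3 : (-d) ^ j ≠ 0 := pow_ne_zero _ (neg_ne_zero.2 hd0)
  have p4 : (-q) ^ j ≠ 0 := pow_ne_zero _ (by linarith)
  generalize (∏ i ∈ Finset.range (j + M), q ^ i) = T1 at *
  generalize (∏ i ∈ Finset.range j, q ^ i) = T2 at *
  generalize qPoch q (q ^ (-((j + M : ℕ) : ℤ))) j = X1 at *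
  generalize qPoch q (q ^ (-(x : ℤ))) j = X2 at *
  generalize qPoch q c j = X3 at *
  trans (X1 * X2 * X3 / (qPoch q b j * qPoch q d j * qPoch q q j)) *
    (((-a) ^ j)⁻¹ * (-e) ^ j * q ^ j)
  · clear key2
    generalize ((-a) ^ j)⁻¹ = Y1
    generalize (-e) ^ j = Y2
    generalize q ^ j = Y3 at *
    field_simp
  · rw [key2]
    generalize ((-q ^ (-((j + M : ℕ) : ℤ))) ^ j) = Z1
    generalize (-c) ^ j = Z2
    generalize (-q ^ (-(x : ℤ))) ^ j = Z3
    simp only [mul_inv]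
    generalize (q⁻¹) ^ j = Z4
    field_simp
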